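/- The weight-5 multiple zeta values satisfy 4ζ(1,1,3) = 2ζ(2,1,2) − ζ(1,1,1,2) and 4ζ(1,2,2) = −6ζ(2,1,2) + 5ζ(1,1,1,2); in particular ζ(1,4) = ζ(1,1,3) and ζ(2,3) = ζ(1,2,2). -/

import Mathlib

open scoped ENNReal

/-- Multiple zeta value `ζ(k₁,…,k_r) = Σ_{0<m₁<⋯<m_r} ∏ mᵢ^{-kᵢ}`. -/
noncomputable def mzv (k : List ℕ) : ℝ :=
  ∑' m : {f : Fin k.length → ℕ+ // StrictMono f},
    ∏ i : Fin k.length, ((m.1 i : ℝ) ^ (k.get i))⁻¹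

/-- truncated sums; the head of the list belongs to the largest variable -/
noncomputable def mzW : List ℕ → ℕ → ℝ≥0∞
  | [], n => if n = 0 then 1 else 0
  | k :: l, n => if n = 0 then 0 else ENNReal.ofReal (((n : ℝ) ^ k)⁻¹) * ∑ j ∈ Finset.range n, mzW l j

theorem tsum_lt_ite (f : ℕ → ℝ≥0∞) (n : ℕ) :
    ∑ j ∈ Finset.range n, f j = ∑' j, if j < n then f j else 0 := by
  rw [tsum_eq_sum (s := Finset.range n)]
  · apply Finset.sum_congr rfl
    intro j hj
    simp [Finset.mem_range.1 hj]
  · intro j hj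
    simp at hj
    simp [hj]

theorem tsum_gt_ite (f : ℕ → ℝ≥0∞) (j : ℕ) :
    (∑' n, if j < n then f n else 0) = ∑' d, f (j + d + 1) := by
  rw [← Summable.sum_add_tsum_nat_add' (k := j + 1) ENNReal.summable,
    Finset.sum_eq_zero, zero_add]
  · apply tsum_congr
    intro d
    rw [if_pos (by omega)]
    congr 1
    omega
  · intro i hi
    simp at hi
    rw [if_neg (by omega)]

theorem tri (F : ℕ → ℕ → ℝ≥0∞) :
    ∑' n, ∑ j ∈ Finset.range n, F j n = ∑' j, ∑' d, F j (j + d + 1) := by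
  simp_rw [tsum_lt_ite]
  rw [ENNReal.tsum_comm]
  simp_rw [tsum_gt_ite]

theorem stuffle_split (F : ℕ → ℕ → ℝ≥0∞) :
    ∑' m, ∑' n, F m n = ∑' n, F n n + ∑' n, ∑ j ∈ Finset.range n, F j n
      + ∑' n, ∑ j ∈ Finset.range n, F n j := by
  have h : ∀ m n, F m n = (if m = n then F m n else 0) + (if m < n then F m n else 0)
      + (if n < m then F m n else 0) := by
    intro m n
    rcases lt_trichotomy m n with h | h | h
    · simp [h, h.ne, h.not_gt]
    · simp [h]
    · simp [h, h.ne', h.not_gt]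
  have e : ∑' m, ∑' n, F m n = ∑' m, ∑' n, ((if m = n then F m n else 0)
      + (if m < n then F m n else 0) + (if n < m then F m n else 0)) :=
    tsum_congr fun m => tsum_congr fun n => h m n
  rw [e]
  simp_rw [tsum_lt_ite, ENNReal.tsum_add]
  congr 2
  · apply tsum_congr
    intro m
    rw [tsum_eq_single m]
    · simp
    · intro b hb
      simp [hb.symm]
  · exact ENNReal.tsum_comm

theorem snoc_strictMono {r : ℕ} (g : Fin r → ℕ+) (n : ℕ+) :
    StrictMono (Fin.snoc (α := fun _ => ℕ+) g n : Fin (r+1) → ℕ+) ↔ StrictMono g ∧ ∀ i, g i < n := by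
  constructor
  · intro h
    constructor
    · intro i j hij
      have := h (Fin.castSucc_lt_castSucc_iff.2 hij)
      simpa using this
    · intro i
      have := h (Fin.castSucc_lt_last i)
      simpa using this
  · rintro ⟨h1, h2⟩ i j
    induction j using Fin.lastCases with
    | last =>
      induction i using Fin.lastCases with
      | last => intro h; exact absurd h (lt_irrefl _)
      | cast i => intro _; simpa using h2 i
    | cast j =>
      induction i using Fin.lastCases with
      | last => intro h; exact absurd h (not_lt.2 (Fin.le_last _))
      | cast i => intro h; simpa using h1 (Fin.castSucc_lt_castSucc_iff.1 h)

open Classical in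
theorem mz_gen (r : ℕ) : ∀ (k : Fin r → ℕ) (φ : ℕ → ℝ≥0∞),
    (∑' f : Fin r → ℕ+, if StrictMono f then
      (∏ i, ENNReal.ofReal (((f i : ℝ) ^ (k i))⁻¹)) * φ (Finset.univ.sup fun i => (f i : ℕ)) else 0)
    = ∑' n, mzW (List.ofFn k).reverse n * φ n := by
  induction r with
  | zero =>
    intro k φ
    rw [tsum_eq_single (default : Fin 0 → ℕ+) (by intro b hb; exact absurd (Subsingleton.elim _ _) hb)]
    rw [tsum_eq_single 0 (by intro b hb; simp [mzW, hb])]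
    rw [if_pos (Subsingleton.strictMono _)]
    simp [mzW]
  | succ r ih =>
    intro k φ
    rw [← (Fin.snocEquiv (fun _ : Fin (r+1) => ℕ+)).tsum_eq, ENNReal.tsum_prod', ENNReal.tsum_comm]
    have e : ∀ x : ℕ+ × (Fin r → ℕ+), (Fin.snocEquiv (fun _ : Fin (r+1) => ℕ+)) x = Fin.snoc (α := fun _ => ℕ+) x.2 x.1 := fun x => rfl
    have key : ∀ g : Fin r → ℕ+, (∑' n : ℕ+, if StrictMono (Fin.snocEquiv (fun _ : Fin (r+1) => ℕ+) (n, g)) then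
      (∏ i, ENNReal.ofReal ((((Fin.snocEquiv (fun _ : Fin (r+1) => ℕ+) (n, g)) i : ℝ) ^ (k i))⁻¹)) * φ (Finset.univ.sup fun i => ((Fin.snocEquiv (fun _ : Fin (r+1) => ℕ+) (n, g)) i : ℕ)) else 0)
      = if StrictMono g then (∏ i, ENNReal.ofReal (((g i : ℝ) ^ (k i.castSucc))⁻¹)) *
        (fun s => ∑' n : ℕ, if s < n then ENNReal.ofReal (((n : ℝ) ^ (k (Fin.last r)))⁻¹) * φ n else 0)
          (Finset.univ.sup fun i => (g i : ℕ)) else 0 := by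
      intro g
      by_cases hg : StrictMono g
      swap
      · rw [if_neg hg]
        simp only [e, snoc_strictMono, hg, false_and, if_false, tsum_zero]
      rw [if_pos hg]
      simp only
      rw [tsum_eq_zero_add' ENNReal.summable, if_neg (Nat.not_lt_zero _), zero_add,
        ← Equiv.pnatEquivNat.symm.tsum_eq, ← ENNReal.tsum_mul_left]
      apply tsum_congr
      intro n
      have hn : ((Equiv.pnatEquivNat.symm n : ℕ+) : ℕ) = n + 1 := by simp
      have hlt : (∀ i, g i < Equiv.pnatEquivNat.symm n) ↔ (Finset.univ.sup fun i => (g i : ℕ)) < n + 1 := by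
        rw [Finset.sup_lt_iff (by simp)]
        simp only [← PNat.coe_lt_coe, hn, Finset.mem_univ, true_imp_iff]
      simp only [e, snoc_strictMono, hg, true_and, hlt]
      split_ifs with h
      · rw [Fin.prod_univ_castSucc]
        have hs : (Finset.univ.sup fun i => ((Fin.snoc (α := fun _ => ℕ+) g (Equiv.pnatEquivNat.symm n) : Fin (r+1) → ℕ+) i : ℕ)) = n + 1 := by
          apply le_antisymm
          · apply Finset.sup_le
            intro i _
            induction i using Fin.lastCases with
            | last => simp
            | cast i =>
              have := (Finset.sup_lt_iff (by simp)).1 h i (Finset.mem_univ _)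
              simpa using this.le
          · refine le_trans ?_ (Finset.le_sup (Finset.mem_univ (Fin.last r)))
            simp
        rw [hs]
        simp [mul_assoc]
      · simp
    rw [tsum_congr key, ih (fun i => k i.castSucc) (fun s => ∑' n : ℕ, if s < n then ENNReal.ofReal (((n : ℝ) ^ (k (Fin.last r)))⁻¹) * φ n else 0)]
    rw [List.ofFn_succ', List.concat_eq_append, List.reverse_append]
    simp only [List.reverse_cons, List.reverse_nil, List.nil_append, List.cons_append]
    simp_rw [← ENNReal.tsum_mul_left]
    rw [ENNReal.tsum_comm]
    apply tsum_congr
    intro n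
    rcases Nat.eq_zero_or_pos n with h | h
    · simp [h, mzW]
    · rw [mzW, if_neg h.ne', tsum_lt_ite, mul_right_comm, ← ENNReal.tsum_mul_left]
      apply tsum_congr
      intro j
      split_ifs
      · ring
      · simp

theorem mzv_eq (k : List ℕ) : mzv k = (∑' n, mzW k.reverse n).toReal := by
  classical
  have h := mz_gen k.length k.get (fun _ => 1)
  simp only [mul_one, List.ofFn_get] at h
  rw [← h]
  rw [mzv]
  have := tsum_subtype {f : Fin k.length → ℕ+ | StrictMono f} (fun f =>
      (∏ i, ENNReal.ofReal (((f i : ℝ) ^ (k.get i))⁻¹)))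
  have h2 : (∑' f : Fin k.length → ℕ+, if StrictMono f then
      (∏ i, ENNReal.ofReal (((f i : ℝ) ^ (k.get i))⁻¹)) else 0) =
      ∑' m : {f : Fin k.length → ℕ+ // StrictMono f}, ENNReal.ofReal (∏ i, (((m.1 i : ℝ) ^ (k.get i))⁻¹)) := by
    refine Eq.trans ?_ (this.symm.trans ?_)
    · apply tsum_congr
      intro f
      simp [Set.indicator]
    · apply tsum_congr
      intro f
      rw [ENNReal.ofReal_prod_of_nonneg]
      intro i _
      positivity
  rw [h2, ENNReal.tsum_toReal_eq (by simp)]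
  apply tsum_congr
  intro f
  rw [ENNReal.toReal_ofReal]
  positivity

theorem tele (f : ℕ → ℝ) (hf : ∀ n, f (n+1) ≤ f n) (h0 : Filter.Tendsto f Filter.atTop (nhds 0)) :
    ∑' n, ENNReal.ofReal (f n - f (n+1)) = ENNReal.ofReal (f 0) := by
  have hs : HasSum (fun n => f n - f (n+1)) (f 0) := by
    rw [hasSum_iff_tendsto_nat_of_nonneg (fun n => sub_nonneg.2 (hf n))]
    simp_rw [Finset.sum_range_sub']
    simpa using h0.const_sub (f 0)
  rw [← ENNReal.ofReal_tsum_of_nonneg (fun n => sub_nonneg.2 (hf n)) hs.summable, hs.tsum_eq]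

/-- connector -/
noncomputable def con (m n : ℕ) : ℝ := (((m + n).choose m : ℕ) : ℝ)⁻¹

theorem con_comm (m n : ℕ) : con m n = con n m := by
  rw [con, con, add_comm n m, Nat.choose_symm_add]

theorem con_step (m n : ℕ) : con (m+1) n - con (m+1) (n+1) = (m+1) * ((n + 1 : ℝ)⁻¹ * con (m+1) (n+1)) := by
  have h1 : 0 < (m+1+n).choose (m+1) := Nat.choose_pos (by omega)
  have h2 : 0 < (m+1+(n+1)).choose (m+1) := Nat.choose_pos (by omega)
  have h := Nat.add_one_mul_choose_eq (m+1+n) n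
  rw [← Nat.choose_symm_add (a := m+1) (b := n)] at h
  have h3 : (m+1+n).succ.choose n.succ = (m+1+(n+1)).choose (m+1) := by
    rw [show (m+1+n).succ = (m+1) + (n+1) by omega, Nat.choose_symm_add]
  rw [h3] at h
  unfold con
  have h' : ((m:ℝ)+1+n+1) * ((m+1+n).choose (m+1) : ℕ) = ((m+1+(n+1)).choose (m+1) : ℕ) * ((n:ℝ)+1) := by
    exact_mod_cast h
  have p1 : (0:ℝ) < ((m+1+n).choose (m+1) : ℕ) := by exact_mod_cast h1
  have p2 : (0:ℝ) < ((m+1+(n+1)).choose (m+1) : ℕ) := by exact_mod_cast h2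
  generalize (((m+1+n).choose (m+1) : ℕ) : ℝ) = x at *
  generalize (((m+1+(n+1)).choose (m+1) : ℕ) : ℝ) = y at *
  field_simp
  linarith

theorem con_nonneg (m n : ℕ) : 0 ≤ con m n := by unfold con; positivity

theorem con_tendsto (m : ℕ) : Filter.Tendsto (fun n => con (m+1) n) Filter.atTop (nhds 0) := by
  refine squeeze_zero (fun n => con_nonneg _ _) (g := fun n : ℕ => 1 / ((n:ℝ) + 1)) ?_
    tendsto_one_div_add_atTop_nhds_zero_nat
  intro n
  unfold con
  rw [one_div]
  apply inv_anti₀ (by positivity)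
  have : n + 1 ≤ (m+1+n).choose (m+1) := by
    rw [Nat.choose_symm_add]
    calc n + 1 = (n+1).choose n := by simp
      _ ≤ _ := Nat.choose_le_choose n (by omega)
  exact_mod_cast this

theorem con_sum (m n : ℕ) :
    ∑' d : ℕ, ENNReal.ofReal (((n + d + 1 : ℕ) : ℝ)⁻¹) * ENNReal.ofReal (con (m+1) (n+d+1))
      = ENNReal.ofReal (((m+1 : ℕ) : ℝ)⁻¹) * ENNReal.ofReal (con (m+1) n) := by
  have hstep : ∀ k, 0 ≤ con (m+1) k - con (m+1) (k+1) := by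
    intro k
    rw [con_step]
    have := con_nonneg (m+1) (k+1)
    positivity
  have h := tele (fun d => ((m+1 : ℕ) : ℝ)⁻¹ * con (m+1) (n+d)) ?_ ?_
  · rw [← ENNReal.ofReal_mul (by positivity)]
    simp only [add_zero] at h
    rw [← h]
    apply tsum_congr
    intro d
    rw [← ENNReal.ofReal_mul (by positivity), ← mul_sub, ← add_assoc, con_step]
    congr 1
    push_cast
    have : (m:ℝ) + 1 ≠ 0 := by positivity
    field_simp
  · intro d
    have := hstep (n+d)
    apply mul_le_mul_of_nonneg_left _ (by positivity)
    rw [← add_assoc]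
    linarith
  · have := ((Filter.tendsto_add_atTop_iff_nat n).2 (con_tendsto m)).const_mul (((m+1 : ℕ) : ℝ)⁻¹)
    rw [mul_zero] at this
    simp_rw [add_comm n]
    exact this

noncomputable def mzZ (l l' : List ℕ) : ℝ≥0∞ :=
  ∑' m, ∑' n, mzW l m * ENNReal.ofReal (con m n) * mzW l' n

theorem mzZ_comm (l l' : List ℕ) : mzZ l l' = mzZ l' l := by
  unfold mzZ
  rw [ENNReal.tsum_comm]
  apply tsum_congr; intro m
  apply tsum_congr; intro n
  rw [con_comm]; ring

theorem mzZ_nil (l : List ℕ) : mzZ l [] = ∑' n, mzW l n := by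
  unfold mzZ
  apply tsum_congr; intro m
  rw [tsum_eq_single 0]
  · simp [mzW, con]
  · intro b hb
    simp [mzW, hb]

theorem mzW_succ (k : ℕ) (l : List ℕ) (m : ℕ) :
    mzW ((k+1) :: l) (m+1) = mzW (k :: l) (m+1) * ENNReal.ofReal (((m+1 : ℕ) : ℝ)⁻¹) := by
  simp only [mzW, if_neg (Nat.succ_ne_zero m)]
  rw [pow_succ, mul_inv, ENNReal.ofReal_mul (by positivity)]
  ring

theorem mzZ_transport (k : ℕ) (l l' : List ℕ) : mzZ ((k+1) :: l) l' = mzZ (k :: l) (1 :: l') := by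
  unfold mzZ
  apply tsum_congr; intro m
  rcases m with _ | m
  · simp [mzW]
  rw [mzW_succ]
  simp_rw [mul_assoc, ENNReal.tsum_mul_left]
  congr 1
  rw [← ENNReal.tsum_mul_left]
  have e : ∀ n, ENNReal.ofReal (con (m+1) n) * mzW (1 :: l') n
      = ∑ j ∈ Finset.range n, mzW l' j * (ENNReal.ofReal ((n : ℝ)⁻¹) * ENNReal.ofReal (con (m+1) n)) := by
    intro n
    rcases Nat.eq_zero_or_pos n with h | h
    · simp [h, mzW]
    · rw [mzW, if_neg h.ne', ← Finset.sum_mul, pow_one]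
      ring
  simp_rw [e]
  rw [tri]
  apply tsum_congr; intro n
  rw [ENNReal.tsum_mul_left, con_sum]
  ring

theorem mzZ_transport' (k : ℕ) (l l' : List ℕ) : mzZ (1 :: l) (k :: l') = mzZ l ((k+1) :: l') := by
  rw [mzZ_comm l, mzZ_transport k, mzZ_comm (k :: l')]

/-- the value in ENNReal -/
noncomputable def mzE (l : List ℕ) : ℝ≥0∞ := ∑' n, mzW l n

theorem dual_a : mzE [4,1] = mzE [3,1,1] := by
  unfold mzE
  rw [← mzZ_nil, ← mzZ_nil, mzZ_transport, mzZ_transport, mzZ_transport, mzZ_transport', mzZ_transport', mzZ_comm]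
theorem dual_b : mzE [3,2] = mzE [2,2,1] := by
  unfold mzE
  rw [← mzZ_nil, ← mzZ_nil, mzZ_transport, mzZ_transport, mzZ_transport', mzZ_transport, mzZ_transport', mzZ_comm]
theorem dual_c : mzE [2,3] = mzE [2,1,2] := by
  unfold mzE
  rw [← mzZ_nil, ← mzZ_nil, mzZ_transport, mzZ_transport', mzZ_transport, mzZ_transport, mzZ_transport', mzZ_comm]
theorem dual_d : mzE [5] = mzE [2,1,1,1] := by
  unfold mzE
  rw [← mzZ_nil, ← mzZ_nil, mzZ_transport, mzZ_transport, mzZ_transport, mzZ_transport, mzZ_transport', mzZ_comm]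

/-- basic term -/
noncomputable def iv (k n : ℕ) : ℝ≥0∞ := ENNReal.ofReal ((((n + 1 : ℕ) : ℝ) ^ k)⁻¹)

theorem mzW_one (k n : ℕ) : mzW [k] (n+1) = iv k n := by
  simp only [mzW, if_neg (Nat.succ_ne_zero n), iv]
  rw [Finset.sum_range_succ']
  simp

theorem mzE_one (k : ℕ) : mzE [k] = ∑' n, iv k n := by
  rw [mzE, tsum_eq_zero_add' ENNReal.summable]
  simp_rw [mzW_one]
  simp [mzW]

theorem mzE_two (a b : ℕ) : mzE [b, a] = ∑' n, ∑ j ∈ Finset.range n, iv a j * iv b n := by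
  rw [mzE, tsum_eq_zero_add' ENNReal.summable]
  have h : ∀ n, mzW [b, a] (n+1) = ∑ j ∈ Finset.range n, iv a j * iv b n := by
    intro n
    rw [mzW, if_neg (Nat.succ_ne_zero n), Finset.sum_range_succ', ← Finset.sum_mul]
    simp_rw [mzW_one]
    rw [mzW, if_pos rfl, add_zero, mul_comm, iv]
  simp_rw [h]
  simp [mzW]

theorem mzE_two' (a b : ℕ) : mzE [b, a] = ∑' j, ∑' d, iv a j * iv b (j + d + 1) := by
  rw [mzE_two, tri (fun j n => iv a j * iv b n)]

theorem iv_summable (k : ℕ) (hk : 2 ≤ k) : ∑' n, iv k n ≠ ⊤ := by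
  unfold iv
  rw [← ENNReal.ofReal_tsum_of_nonneg (fun n => by positivity)]
  · simp
  · exact (summable_nat_add_iff 1).2 (Real.summable_nat_pow_inv.2 (by omega))

theorem a_fin : mzE [4,1] ≠ ⊤ := by
  rw [mzE_two]
  refine ne_top_of_le_ne_top (iv_summable 3 (by norm_num)) (ENNReal.tsum_le_tsum fun n => ?_)
  calc ∑ j ∈ Finset.range n, iv 1 j * iv 4 n ≤ ∑ j ∈ Finset.range n, 1 * iv 4 n := by
        gcongr with j hj
        unfold iv
        rw [ENNReal.ofReal_le_one]
        apply inv_le_one_of_one_le₀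
        rw [pow_one]
        exact_mod_cast Nat.succ_le_succ (Nat.zero_le j)
    _ ≤ iv 3 n := by
        rw [Finset.sum_const, Finset.card_range, one_mul, nsmul_eq_mul]
        unfold iv
        rw [← ENNReal.ofReal_natCast, ← ENNReal.ofReal_mul (by positivity)]
        apply ENNReal.ofReal_le_ofReal
        push_cast
        have : (0:ℝ) < n + 1 := by positivity
        field_simp
        linarith

theorem iv_mul (a b m n : ℕ) : iv a m * iv b n =
    ENNReal.ofReal ((((m + 1 : ℕ) : ℝ) ^ a)⁻¹ * (((n + 1 : ℕ) : ℝ) ^ b)⁻¹) := by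
  rw [iv, iv, ENNReal.ofReal_mul (by positivity)]

theorem harm (m : ℕ) : ∑' d, iv 1 d * iv 1 (m + d + 1) = iv 1 m * ∑ j ∈ Finset.range (m+1), iv 1 j := by
  have ht : ∀ j : ℕ, ∑' d : ℕ, ENNReal.ofReal (((d + j + 1 : ℕ) : ℝ)⁻¹ - ((d + 1 + j + 1 : ℕ) : ℝ)⁻¹) = iv 1 j := by
    intro j
    have := tele (fun d => ((d + j + 1 : ℕ) : ℝ)⁻¹) ?_ ?_
    · rw [this]; simp [iv]
    · intro n
      apply inv_anti₀ (by positivity)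
      push_cast; linarith
    · have := (Filter.tendsto_add_atTop_iff_nat j).2 (tendsto_one_div_add_atTop_nhds_zero_nat (𝕜 := ℝ))
      simpa using this
  rw [← Finset.sum_congr rfl (fun j _ => ht j)]
  rw [← Summable.tsum_finsetSum (fun i _ => ENNReal.summable), ← ENNReal.tsum_mul_left]
  apply tsum_congr; intro d
  rw [← ENNReal.ofReal_sum_of_nonneg]
  · have : ∀ j : ℕ, d + 1 + j + 1 = d + (j + 1) + 1 := fun j => by ring
    simp_rw [this]
    rw [Finset.sum_range_sub' (fun j => ((d + j + 1 : ℕ) : ℝ)⁻¹), iv_mul, iv,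
      ← ENNReal.ofReal_mul (by positivity)]
    congr 1
    push_cast
    have : (0:ℝ) < d + 1 := by positivity
    have : (0:ℝ) < m + 1 := by positivity
    have : (0:ℝ) < m + d + 1 + 1 := by positivity
    have : (0:ℝ) < d + (m + 1) + 1 := by positivity
    field_simp
    ring
  · intro j _
    rw [sub_nonneg]
    apply inv_anti₀ (by positivity)
    push_cast; linarith

theorem sum_formula : mzE [4,1] + mzE [3,2] + mzE [2,3] = mzE [5] := by
  have h : mzE [4,1] + mzE [3,2] + mzE [2,3] + mzE [4,1] = mzE [5] + mzE [4,1] := by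
    have e1 : mzE [5] + mzE [4,1] = ∑' m, ∑' d, iv 3 m * (iv 1 d * iv 1 (m + d + 1)) := by
      simp_rw [ENNReal.tsum_mul_left, harm]
      rw [mzE_one, mzE_two, ← ENNReal.tsum_add]
      apply tsum_congr; intro n
      have h5 : iv 5 n = iv 3 n * iv 1 n * iv 1 n := by
        simp only [iv]
        rw [← ENNReal.ofReal_mul (by positivity), ← ENNReal.ofReal_mul (by positivity)]
        congr 1
        rw [← mul_inv, ← mul_inv]; ring
      have h4 : iv 4 n = iv 3 n * iv 1 n := by
        rw [iv_mul, iv, ← mul_inv]; congr 1; ring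
      rw [Finset.sum_range_succ, h5, h4, ← Finset.sum_mul]
      ring
    have e2 : mzE [4,1] = ∑' j, ∑' d, iv 1 d * iv 4 (j + d + 1) := by
      rw [mzE_two', ENNReal.tsum_comm]
      simp_rw [add_comm]
    rw [e1]
    nth_rewrite 2 [e2]
    rw [mzE_two', mzE_two', mzE_two']
    simp_rw [← ENNReal.tsum_add]
    apply tsum_congr; intro m
    apply tsum_congr; intro d
    simp only [iv_mul]
    rw [iv, ← ENNReal.ofReal_mul (by positivity), ← ENNReal.ofReal_add (by positivity) (by positivity),
      ← ENNReal.ofReal_add (by positivity) (by positivity), ← ENNReal.ofReal_add (by positivity) (by positivity)]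
    congr 1
    push_cast
    have : (0:ℝ) < d + 1 := by positivity
    have : (0:ℝ) < m + 1 := by positivity
    have : (0:ℝ) < m + d + 1 + 1 := by positivity
    field_simp
    ring
  exact (ENNReal.add_left_inj a_fin).1 h

theorem double_shuffle : mzE [5] + mzE [2,3] + mzE [3,2] = mzE [2,3] + 3 * mzE [3,2] + 6 * mzE [4,1] := by
  have hs := stuffle_split (fun m n => iv 3 m * iv 2 n)
  have e1 : mzE [5] + mzE [2,3] + mzE [3,2] = ∑' m, ∑' n, iv 3 m * iv 2 n := by
    rw [hs, mzE_one, mzE_two, mzE_two]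
    congr 2
    · apply tsum_congr; intro n
      rw [iv_mul, iv, ← mul_inv]; congr 1; ring
    · simp_rw [mul_comm]
  rw [e1]
  have sw : ∀ a b, mzE [b, a] = ∑' j, ∑' d, iv a d * iv b (j + d + 1) := by
    intro a b
    rw [mzE_two', ENNReal.tsum_comm]
    simp_rw [add_comm]
  have e2 : mzE [2,3] + 3 * mzE [3,2] + 6 * mzE [4,1] =
      mzE [2,3] + 2 * mzE [3,2] + 3 * mzE [4,1] + mzE [3,2] + 3 * mzE [4,1] := by ring
  rw [e2]
  nth_rewrite 2 [sw 1 4]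
  nth_rewrite 2 [sw 2 3]
  rw [mzE_two', mzE_two', mzE_two']
  simp_rw [← ENNReal.tsum_mul_left, ← ENNReal.tsum_add]
  apply tsum_congr; intro m
  apply tsum_congr; intro d
  simp only [iv_mul]
  have t2 : (2 : ℝ≥0∞) = ENNReal.ofReal 2 := by simp
  have t3 : (3 : ℝ≥0∞) = ENNReal.ofReal 3 := by simp
  rw [t2, t3]
  repeat rw [← ENNReal.ofReal_mul (by positivity)]
  repeat rw [← ENNReal.ofReal_add (by positivity) (by positivity)]
  congr 1
  push_cast
  have : (0:ℝ) < d + 1 := by positivity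
  have : (0:ℝ) < m + 1 := by positivity
  have : (0:ℝ) < m + d + 1 + 1 := by positivity
  field_simp
  ring

theorem mzv_rel_12 :
    (4 * mzv [1,1,3] = 2 * mzv [2,1,2] - mzv [1,1,1,2] ∧
      4 * mzv [1,2,2] = -6 * mzv [2,1,2] + 5 * mzv [1,1,1,2]) ∧
    mzv [1,4] = mzv [1,1,3] ∧ mzv [2,3] = mzv [1,2,2] := by
  have v : ∀ k, mzv k = (mzE k.reverse).toReal := mzv_eq
  simp only [v, List.reverse_cons, List.reverse_nil, List.nil_append, List.cons_append]
  rw [← dual_a, ← dual_b, ← dual_c, ← dual_d]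
  have f5 : mzE [5] ≠ ⊤ := by rw [mzE_one]; exact iv_summable 5 (by norm_num)
  have hsum := sum_formula
  have f1 := a_fin
  have f2 : mzE [3,2] ≠ ⊤ := ne_top_of_le_ne_top f5 (by rw [← hsum, add_right_comm]; exact le_add_self)
  have f3 : mzE [2,3] ≠ ⊤ := ne_top_of_le_ne_top f5 (by rw [← hsum]; exact le_add_self)
  have hds := double_shuffle
  have r1 := congrArg ENNReal.toReal hsum
  have r2 := congrArg ENNReal.toReal hds
  rw [ENNReal.toReal_add (by finiteness) f3, ENNReal.toReal_add f1 f2] at r1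
  rw [ENNReal.toReal_add (by finiteness) (by finiteness), ENNReal.toReal_add (by finiteness) (by finiteness),
    ENNReal.toReal_add (by finiteness) (by finiteness), ENNReal.toReal_add (by finiteness) (by finiteness),
    ENNReal.toReal_mul, ENNReal.toReal_mul] at r2
  norm_num at r2
  refine ⟨⟨?_, ?_⟩, rfl, rfl⟩ <;> linarith
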